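/- Let w, w' ∈ W^J. If there exists some v' ∈ (W_J · w')_min for which there is v ∈ (W_J · w)_min with v ≤ v', then for every u' ∈ (W_J · w')_min there exists u ∈ (W_J · w)_min with u ≤ u'. (In other words, in the definition of the relation ≤_{J,δ}, 'for some minimal element' is equivalent to 'for any minimal element'.) -/

import Mathlib

namespace HePaper

variable {I : Type*} {M : CoxeterMatrix I} {W : Type*} [Group W]

/-- The standard parabolic subgroup `W_J` generated by the simple reflections `s_j`, `j ∈ J`. -/
def parabolic (cs : CoxeterSystem M W) (J : Set I) : Subgroup W :=
  Subgroup.closure (cs.simple '' J)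

/-- `W^J`, the set of minimal length coset representatives for `W/W_J`. -/
def minRight (cs : CoxeterSystem M W) (J : Set I) : Set W :=
  {w : W | ∀ j ∈ J, cs.length w < cs.length (w * cs.simple j)}

/-- `^J W`, the set of minimal length coset representatives for `W_J\W`. -/
def minLeft (cs : CoxeterSystem M W) (J : Set I) : Set W :=
  {w : W | ∀ j ∈ J, cs.length w < cs.length (cs.simple j * w)}

/-- `Ad(u)(K) = {k ∈ I : s_k = u s_j u⁻¹ for some j ∈ K}`. -/
def AdSet (cs : CoxeterSystem M W) (u : W) (K : Set I) : Set I :=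
  {k : I | ∃ j ∈ K, cs.simple k = u * cs.simple j * u⁻¹}

/-- Membership in the set `T(J, δ)` of sequences `(J_n, w_n)_{n ≥ 0}`. -/
def InT (cs : CoxeterSystem M W) (J : Set I) (δ : I ≃ I)
    (Jseq : ℕ → Set I) (wseq : ℕ → W) : Prop :=
  Jseq 0 = J ∧
  (∀ n : ℕ, Jseq (n + 1) = Jseq n ∩ AdSet cs (wseq n) (δ '' Jseq n)) ∧
  (∀ n : ℕ, wseq n ∈ minLeft cs (Jseq n) ∩ minRight cs (δ '' Jseq n)) ∧
  (∀ n : ℕ, ∃ x ∈ parabolic cs (Jseq (n + 1)), ∃ y ∈ parabolic cs (δ '' Jseq n),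
      wseq (n + 1) = x * wseq n * y)

/-- `I(J, δ; w)`: the largest subset `K ⊆ J` with `Ad(w)(K) = δ(K)`. -/
def IJdw (cs : CoxeterSystem M W) (J : Set I) (δ : I ≃ I) (w : W) : Set I :=
  ⋃₀ {K : Set I | K ⊆ J ∧ AdSet cs w K = δ '' K}

/-- The orbit of `w` under the `W_J`-action `x · y = δ(x) y x⁻¹`. -/
def orbit (cs : CoxeterSystem M W) (J : Set I) (δW : W ≃* W) (w : W) : Set W :=
  {y : W | ∃ x ∈ parabolic cs J, y = δW x * w * x⁻¹}

/-- The set of elements of minimal length in the orbit of `w`. -/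
def orbitMin (cs : CoxeterSystem M W) (J : Set I) (δW : W ≃* W) (w : W) : Set W :=
  {v ∈ orbit cs J δW w | ∀ u ∈ orbit cs J δW w, cs.length v ≤ cs.length u}

/-- `w →_{s_j} w'` for some `j ∈ J`: `w' = s_{δ(j)} w s_j` and `ℓ(w') ≤ ℓ(w)`. -/
def stepTo (cs : CoxeterSystem M W) (J : Set I) (δ : I ≃ I) (w w' : W) : Prop :=
  ∃ j ∈ J, w' = cs.simple (δ j) * w * cs.simple j ∧ cs.length w' ≤ cs.length w

/-- `w →_{J,δ} w'`. -/
def toRel (cs : CoxeterSystem M W) (J : Set I) (δ : I ≃ I) : W → W → Prop :=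
  Relation.ReflTransGen (stepTo cs J δ)

/-- `w` and `w'` are elementarily strongly `(J, δ)`-conjugate. -/
def ElemStrong (cs : CoxeterSystem M W) (J : Set I) (δW : W ≃* W) (w w' : W) : Prop :=
  cs.length w = cs.length w' ∧
  ∃ x ∈ parabolic cs J, w' = δW x * w * x⁻¹ ∧
    (cs.length (δW x * w) = cs.length x + cs.length w ∨
     cs.length (w * x⁻¹) = cs.length x + cs.length w)

/-- `w ∼_{J,δ} w'`: strongly `(J, δ)`-conjugate. -/
def simRel (cs : CoxeterSystem M W) (J : Set I) (δW : W ≃* W) : W → W → Prop :=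
  Relation.ReflTransGen (ElemStrong cs J δW)

/-- The Bruhat order on `W`: some reduced word for `w` contains a subword that is a
reduced word for `u`. -/
def bruhatLE (cs : CoxeterSystem M W) (u w : W) : Prop :=
  ∃ ω : List I, cs.wordProd ω = w ∧ cs.IsReduced ω ∧
    ∃ ω' : List I, ω'.Sublist ω ∧ cs.wordProd ω' = u ∧ cs.IsReduced ω'

/-- `supp(w)`: the smallest subset `K ⊆ I` with `w ∈ W_K`. -/
def supp (cs : CoxeterSystem M W) (w : W) : Set I :=
  ⋂₀ {K : Set I | w ∈ parabolic cs K}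

/-- `supp_δ(w)`: the smallest `δ`-stable subset of `I` containing `supp(w)`. -/
def suppDelta (cs : CoxeterSystem M W) (δ : I ≃ I) (w : W) : Set I :=
  ⋃ n : ℕ, (⇑δ)^[n] '' supp cs w

/-- `w ≤_{J,δ} w'` for `w, w' ∈ W^J`. -/
def leJd (cs : CoxeterSystem M W) (J : Set I) (δW : W ≃* W) (w w' : W) : Prop :=
  ∀ v' ∈ orbitMin cs J δW w', ∃ v ∈ orbitMin cs J δW w, bruhatLE cs v v'

section StrongExchange

variable (cs : CoxeterSystem M W)

open Classical in
/-- The permutation of `W × ℤ/2` attached to a simple reflection: it conjugates the first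
coordinate, and flips the second one at the reflection itself. -/
noncomputable def signedConj (i : I) : Equiv.Perm (W × ZMod 2) :=
  Function.Involutive.toPerm
    (fun p => (cs.simple i * p.1 * cs.simple i, p.2 + if p.1 = cs.simple i then 1 else 0)) <| by
      rintro ⟨t, e⟩
      have h : cs.simple i * t * cs.simple i = cs.simple i ↔ t = cs.simple i := by
        constructor
        · intro h
          have := congrArg (fun x => cs.simple i * x * cs.simple i) h
          simpa [mul_assoc] using this
        · rintro rfl
          simp
      apply Prod.ext
      · simp [mul_assoc]
      · change e + (if t = cs.simple i then 1 else 0) +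
          (if cs.simple i * t * cs.simple i = cs.simple i then 1 else 0) = e
        simp only [h, add_assoc, CharTwo.add_self_eq_zero, add_zero]

open Classical in
theorem prod_signedConj_apply (ω : List I) (t : W) (e : ZMod 2) :
    (ω.map (signedConj cs)).prod
      ((cs.wordProd ω)⁻¹ * t * cs.wordProd ω, e + ((cs.leftInvSeq ω).count t : ZMod 2)) =
      (t, e) := by
  induction ω generalizing t e with
  | nil => simp
  | cons i ω ih =>
    have hcount : (cs.leftInvSeq (i :: ω)).count t =
        (cs.leftInvSeq ω).count (cs.simple i * t * cs.simple i) +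
          if t = cs.simple i then 1 else 0 := by
      have h1 : t = MulAut.conj (cs.simple i) (cs.simple i * t * cs.simple i) := by
        simp [mul_assoc]
      rw [CoxeterSystem.leftInvSeq, List.count_cons]
      conv_lhs =>
        enter [1]
        rw [h1, List.count_map_of_injective _ _ (MulAut.conj (cs.simple i)).injective]
      simp only [beq_iff_eq, @eq_comm _ (cs.simple i) t]
    have hconj : (cs.wordProd (i :: ω))⁻¹ * t * cs.wordProd (i :: ω) =
        (cs.wordProd ω)⁻¹ * (cs.simple i * t * cs.simple i) * cs.wordProd ω := by
      simp [cs.wordProd_cons, mul_assoc]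
    have h := ih (cs.simple i * t * cs.simple i) (e + if t = cs.simple i then 1 else 0)
    rw [hcount, hconj, List.map_cons, List.prod_cons, Equiv.Perm.mul_apply]
    have he : e + (((cs.leftInvSeq ω).count (cs.simple i * t * cs.simple i) +
          if t = cs.simple i then 1 else 0 : ℕ) : ZMod 2) =
        (e + if t = cs.simple i then 1 else 0) +
          ((cs.leftInvSeq ω).count (cs.simple i * t * cs.simple i) : ZMod 2) := by
      push_cast
      ring
    rw [he, h]
    have h2 : cs.simple i * t * cs.simple i = cs.simple i ↔ t = cs.simple i := by
      constructor
      · intro h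
        have := congrArg (fun x => cs.simple i * x * cs.simple i) h
        simpa [mul_assoc] using this
      · rintro rfl
        simp
    apply Prod.ext
    · change cs.simple i * (cs.simple i * t * cs.simple i) * cs.simple i = t
      simp [mul_assoc]
    · change e + (if t = cs.simple i then 1 else 0) +
          (if cs.simple i * t * cs.simple i = cs.simple i then 1 else 0) = e
      simp only [h2, add_assoc, CharTwo.add_self_eq_zero, add_zero]

theorem prod_signedConj_alternatingWord (i j : I) (m : ℕ) :
    ((CoxeterSystem.alternatingWord i j (2 * m)).map (signedConj cs)).prod =
      (signedConj cs i * signedConj cs j) ^ m := by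
  induction m with
  | zero => simp [CoxeterSystem.alternatingWord]
  | succ m ih =>
    rw [show 2 * (m + 1) = 2 * m + 1 + 1 by ring, CoxeterSystem.alternatingWord_succ,
      CoxeterSystem.alternatingWord_succ, pow_succ, ← ih]
    simp

theorem leftInvSeq_alternatingWord_two_mul (i j : I) :
    cs.leftInvSeq (CoxeterSystem.alternatingWord i j (2 * M i j)) =
      (cs.leftInvSeq (CoxeterSystem.alternatingWord i j (2 * M i j))).take (M i j) ++
      (cs.leftInvSeq (CoxeterSystem.alternatingWord i j (2 * M i j))).take (M i j) := by
  have hlen : (cs.leftInvSeq (CoxeterSystem.alternatingWord i j (2 * M i j))).length =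
      2 * M i j := by simp
  apply List.ext_getElem
  · simp; omega
  · intro n h1 h2
    rw [hlen] at h1
    rw [List.getElem_append]
    split_ifs with h
    · simp
    · have hn : M i j ≤ n := by simp at h; omega
      rw [List.getElem_take]
      have hl : ((cs.leftInvSeq (CoxeterSystem.alternatingWord i j (2 * M i j))).take
        (M i j)).length = M i j := by simp; omega
      simp only [hl]
      rw [cs.getElem_leftInvSeq_alternatingWord i j _ _ h1,
        cs.getElem_leftInvSeq_alternatingWord i j _ _ (by omega),
        cs.prod_alternatingWord_eq_mul_pow, cs.prod_alternatingWord_eq_mul_pow]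
      have h3 : ¬ Even (2 * n + 1) := by simp [parity_simps]
      have h4 : ¬ Even (2 * (n - M i j) + 1) := by simp [parity_simps]
      rw [if_neg h3, if_neg h4, show (2 * n + 1) / 2 = (n - M i j) + M i j by omega,
        show (2 * (n - M i j) + 1) / 2 = n - M i j by omega, pow_add]
      have := cs.simple_mul_simple_pow j i
      rw [M.symmetric j i] at this
      simp [this]

theorem isLiftable_signedConj : M.IsLiftable (signedConj cs) := by
  classical
  intro i j
  rw [← prod_signedConj_alternatingWord]
  ext1 ⟨t, e⟩
  have hw : cs.wordProd (CoxeterSystem.alternatingWord i j (2 * M i j)) = 1 := by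
    simp [cs.prod_alternatingWord_eq_mul_pow]
  have hc : (((cs.leftInvSeq (CoxeterSystem.alternatingWord i j (2 * M i j))).count t : ℕ) :
      ZMod 2) = 0 := by
    rw [leftInvSeq_alternatingWord_two_mul, List.count_append]
    push_cast
    exact CharTwo.add_self_eq_zero _
  have h := prod_signedConj_apply cs (CoxeterSystem.alternatingWord i j (2 * M i j)) t e
  rw [hw, hc] at h
  simpa using h

open Classical in
theorem count_leftInvSeq_eq_of_wordProd_eq {ω ω' : List I}
    (h : cs.wordProd ω = cs.wordProd ω') (t : W) :
    ((cs.leftInvSeq ω).count t : ZMod 2) = ((cs.leftInvSeq ω').count t : ZMod 2) := by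
  have key : ∀ ω : List I, (ω.map (signedConj cs)).prod =
      cs.lift ⟨signedConj cs, isLiftable_signedConj cs⟩ (cs.wordProd ω) := by
    intro ω
    rw [CoxeterSystem.wordProd, map_list_prod, List.map_map]
    congr 2
    ext1 i
    simp [cs.lift_apply_simple]
  have h1 := prod_signedConj_apply cs ω t 0
  have h2 := prod_signedConj_apply cs ω' t 0
  rw [key] at h1 h2
  rw [← h] at h2
  simpa using (Equiv.injective _ (h1.trans h2.symm))

open Classical in
theorem count_leftInvSeq_append (ω ω' : List I) (t : W) :
    (cs.leftInvSeq (ω ++ ω')).count t = (cs.leftInvSeq ω).count t +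
      (cs.leftInvSeq ω').count ((cs.wordProd ω)⁻¹ * t * cs.wordProd ω) := by
  induction ω generalizing t with
  | nil => simp
  | cons i ω ih =>
    have h1 : t = MulAut.conj (cs.simple i) (cs.simple i * t * cs.simple i) := by
      simp [mul_assoc]
    have h2 : ∀ l : List W, (l.map (MulAut.conj (cs.simple i))).count t =
        l.count (cs.simple i * t * cs.simple i) := by
      intro l
      conv_lhs => rw [h1, List.count_map_of_injective _ _ (MulAut.conj (cs.simple i)).injective]
    rw [List.cons_append, CoxeterSystem.leftInvSeq, CoxeterSystem.leftInvSeq, List.count_cons,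
      List.count_cons, h2, h2, ih]
    simp [cs.wordProd_cons, mul_assoc]
    omega

open Classical in
theorem count_leftInvSeq_self {t : W} (ht : cs.IsReflection t) {ω : List I}
    (hω : cs.wordProd ω = t) : ((cs.leftInvSeq ω).count t : ZMod 2) = 1 := by
  obtain ⟨u, i, rfl⟩ := ht
  obtain ⟨υ, rfl⟩ := cs.wordProd_surjective u
  have h : cs.wordProd ω = cs.wordProd (υ ++ ([i] ++ υ.reverse)) := by
    rw [hω]
    simp [cs.wordProd_append, cs.wordProd_cons, mul_assoc]
  have h0 := count_leftInvSeq_eq_of_wordProd_eq cs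
    (show cs.wordProd (υ ++ υ.reverse) = cs.wordProd [] by simp [cs.wordProd_append])
    (cs.wordProd υ * cs.simple i * (cs.wordProd υ)⁻¹)
  rw [count_leftInvSeq_eq_of_wordProd_eq cs h, count_leftInvSeq_append, count_leftInvSeq_append]
  rw [count_leftInvSeq_append] at h0
  simp only [cs.leftInvSeq_nil, List.count_nil] at h0
  have e1 : (cs.wordProd υ)⁻¹ * (cs.wordProd υ * cs.simple i * (cs.wordProd υ)⁻¹) *
      cs.wordProd υ = cs.simple i := by group
  rw [e1] at h0 ⊢
  simp [CoxeterSystem.leftInvSeq] at h0 ⊢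
  linear_combination h0

/-- The strong exchange property. -/
theorem exists_eraseIdx_of_isLeftInversion {ω : List I} {t : W}
    (h : cs.IsLeftInversion (cs.wordProd ω) t) :
    ∃ j < ω.length, t * cs.wordProd ω = cs.wordProd (ω.eraseIdx j) := by
  classical
  have hmem : t ∈ cs.leftInvSeq ω := by
    by_contra hn
    obtain ⟨τ, hτ⟩ := cs.wordProd_surjective t
    obtain ⟨υ, hυ, hυ'⟩ := cs.exists_isReduced (t * cs.wordProd ω)
    have e : cs.wordProd υ = cs.wordProd (τ ++ ω) := by
      rw [← hυ', cs.wordProd_append, hτ]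
    have hc := count_leftInvSeq_eq_of_wordProd_eq cs e t
    rw [count_leftInvSeq_append, hτ, inv_mul_cancel, one_mul, List.count_eq_zero_of_not_mem hn,
      add_zero, count_leftInvSeq_self cs h.1 hτ] at hc
    have hm : t ∈ cs.leftInvSeq υ := by
      by_contra hm
      rw [List.count_eq_zero_of_not_mem hm] at hc
      simp at hc
    have := (cs.isLeftInversion_of_mem_leftInvSeq hυ hm).2
    rw [← hυ', ← mul_assoc, h.1.mul_self, one_mul] at this
    exact absurd this (not_lt.mpr h.2.le)
  obtain ⟨j, hj, rfl⟩ := List.mem_iff_getElem.mp hmem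
  refine ⟨j, by simpa using hj, ?_⟩
  rw [← cs.getD_leftInvSeq_mul_wordProd, List.getD_eq_getElem _ _ hj]

end StrongExchange

section Bruhat

variable {cs : CoxeterSystem M W}

variable (cs) in
/-- Every word has a reduced subword with the same product. -/
theorem exists_isReduced_sublist (ω : List I) :
    ∃ ω' : List I, ω'.Sublist ω ∧ cs.wordProd ω' = cs.wordProd ω ∧ cs.IsReduced ω' := by
  induction ω with
  | nil => exact ⟨[], List.Sublist.refl _, rfl, by simp [CoxeterSystem.IsReduced]⟩
  | cons i ω ih =>
    obtain ⟨υ, hυ, hprod, hred⟩ := ih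
    by_cases h : cs.IsLeftDescent (cs.wordProd υ) i
    · obtain ⟨j, hj, he⟩ := exists_eraseIdx_of_isLeftInversion cs
        ((cs.isLeftInversion_simple_iff_isLeftDescent _ _).mpr h)
      refine ⟨υ.eraseIdx j, ((List.eraseIdx_sublist υ j).trans hυ).cons i, ?_, ?_⟩
      · rw [← he, cs.wordProd_cons, hprod]
      · have h1 := cs.isLeftDescent_iff.mp h
        have h2 := List.length_eraseIdx_of_lt hj
        have h3 := hred.eq
        rw [CoxeterSystem.IsReduced, ← he]
        omega
    · refine ⟨i :: υ, hυ.cons_cons i, by rw [cs.wordProd_cons, cs.wordProd_cons, hprod], ?_⟩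
      rw [CoxeterSystem.IsReduced, cs.wordProd_cons, cs.not_isLeftDescent_iff.mp h, hred.eq,
        List.length_cons]

variable (cs) in
/-- The Bruhat order, as the reflexive transitive closure of length-increasing multiplication
by reflections. -/
def ReflLE : W → W → Prop :=
  Relation.ReflTransGen
    (fun u w => ∃ t, cs.IsReflection t ∧ w = t * u ∧ cs.length u < cs.length w)

theorem ReflLE.refl (u : W) : ReflLE cs u u := Relation.ReflTransGen.refl

theorem ReflLE.trans {u v w : W} (h : ReflLE cs u v) (h' : ReflLE cs v w) : ReflLE cs u w :=
  Relation.ReflTransGen.trans h h'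

theorem reflLE_of_reflection {u t : W} (ht : cs.IsReflection t)
    (h : cs.length u < cs.length (t * u)) : ReflLE cs u (t * u) :=
  Relation.ReflTransGen.single ⟨t, ht, rfl, h⟩

theorem reflLE_simple_mul {u : W} {i : I} (h : cs.length u < cs.length (cs.simple i * u)) :
    ReflLE cs u (cs.simple i * u) :=
  reflLE_of_reflection (cs.isReflection_simple i) h

theorem simple_mul_reflLE {u : W} {i : I} (h : cs.length (cs.simple i * u) < cs.length u) :
    ReflLE cs (cs.simple i * u) u := by
  simpa using reflLE_simple_mul (cs := cs) (u := cs.simple i * u) (i := i) (by simpa using h)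

theorem ReflLE.length_le {u w : W} (h : ReflLE cs u w) : cs.length u ≤ cs.length w := by
  induction h with
  | refl => exact le_rfl
  | tail _ hs ih =>
    obtain ⟨t, -, -, hl⟩ := hs
    exact ih.trans hl.le

theorem ReflLE.inv {u w : W} (h : ReflLE cs u w) : ReflLE cs u⁻¹ w⁻¹ := by
  refine Relation.ReflTransGen.lift (fun x => x⁻¹) ?_ _ _ h
  rintro a b ⟨t, ht, rfl, hl⟩
  refine ⟨a⁻¹ * t * a, by simpa using ht.conj a⁻¹, by simp [ht.inv], ?_⟩
  simpa only [cs.length_inv] using hl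

theorem ReflLE.exists_sublist {u : W} {ω : List I} (h : ReflLE cs u (cs.wordProd ω)) :
    ∃ ω' : List I, ω'.Sublist ω ∧ cs.wordProd ω' = u := by
  induction h using Relation.ReflTransGen.head_induction_on with
  | refl => exact ⟨ω, List.Sublist.refl _, rfl⟩
  | head hs h' ih =>
    rename_i a b
    obtain ⟨t, ht, rfl, hl⟩ := hs
    obtain ⟨υ, hυ, hp⟩ := ih
    have hta : t * (t * a) = a := by rw [← mul_assoc, ht.mul_self, one_mul]
    obtain ⟨j, -, he⟩ := exists_eraseIdx_of_isLeftInversion cs (ω := υ) (t := t)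
      ⟨ht, by rwa [hp, hta]⟩
    exact ⟨υ.eraseIdx j, (List.eraseIdx_sublist υ j).trans hυ, by rw [← he, hp, hta]⟩

theorem length_simple_mul_lt_of_reflection {u t : W} (ht : cs.IsReflection t)
    (hl : cs.length u < cs.length (t * u)) {i : I} (hti : t ≠ cs.simple i) :
    cs.length (cs.simple i * u) < cs.length (cs.simple i * (t * u)) := by
  by_contra hn
  have hne : cs.length (cs.simple i * (t * u)) ≠ cs.length (cs.simple i * u) := by
    have := (ht.conj (cs.simple i)).length_mul_right_ne (cs.simple i * u)
    simpa [mul_assoc] using this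
  have h1 := cs.length_simple_mul u i
  have h2 := cs.length_simple_mul (t * u) i
  obtain ⟨υ, hυ, hp⟩ := cs.exists_isReduced (cs.simple i * (t * u))
  have hp' : cs.wordProd (i :: υ) = t * u := by rw [cs.wordProd_cons, ← hp]; simp
  have htu : t * (t * u) = u := by rw [← mul_assoc, ht.mul_self, one_mul]
  obtain ⟨j, hj, he⟩ := exists_eraseIdx_of_isLeftInversion cs (ω := i :: υ) (t := t)
    ⟨ht, by rwa [hp', htu]⟩
  rw [hp', htu] at he
  cases j with
  | zero =>
    rw [List.eraseIdx_cons_zero, ← hp] at he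
    apply hti
    have : cs.simple i * u = t * u := by
      conv_lhs => rw [he]
      simp
    exact (mul_right_cancel this).symm
  | succ j =>
    rw [List.eraseIdx_cons_succ, cs.wordProd_cons] at he
    have h3 : cs.simple i * u = cs.wordProd (υ.eraseIdx j) := by
      conv_lhs => rw [he]
      simp
    have h4 := cs.length_wordProd_le (υ.eraseIdx j)
    have h5 := hυ.eq
    rw [← h3] at h4
    rw [← hp] at h5
    rw [List.length_cons] at hj
    have h6 := List.length_eraseIdx_of_lt (l := υ) (i := j) (by omega)
    omega

theorem ReflLE.simple_mul {u w : W} (h : ReflLE cs u w) (i : I) :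
    ReflLE cs (cs.simple i * u) w ∨ ReflLE cs (cs.simple i * u) (cs.simple i * w) := by
  induction h using Relation.ReflTransGen.head_induction_on with
  | refl => exact Or.inr (ReflLE.refl _)
  | head hs h' ih =>
    rename_i a b
    obtain ⟨t, ht, rfl, hl⟩ := hs
    by_cases hti : t = cs.simple i
    · subst hti
      exact Or.inl h'
    · have hlt := length_simple_mul_lt_of_reflection ht hl hti
      have hstep : ReflLE cs (cs.simple i * a) (cs.simple i * (t * a)) := by
        have e : cs.simple i * (t * a) =
            cs.simple i * t * (cs.simple i)⁻¹ * (cs.simple i * a) := by group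
        rw [e] at hlt ⊢
        exact reflLE_of_reflection (ht.conj _) hlt
      exact ih.imp hstep.trans hstep.trans

theorem ReflLE.simple_mul_of_lt {u w : W} (h : ReflLE cs u w) {i : I}
    (hi : cs.length w < cs.length (cs.simple i * w)) :
    ReflLE cs (cs.simple i * u) (cs.simple i * w) :=
  (h.simple_mul i).elim (fun h' => h'.trans (reflLE_simple_mul hi)) id

theorem reflLE_of_sublist {ω' ω : List I} (h : ω'.Sublist ω) (hω : cs.IsReduced ω) :
    ReflLE cs (cs.wordProd ω') (cs.wordProd ω) := by
  induction h with
  | slnil => exact ReflLE.refl _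
  | @cons ω' ω i h ih =>
    have hr : cs.IsReduced ω := hω.drop 1
    have h1 := hω.eq
    have h2 := hr.eq
    rw [cs.wordProd_cons, List.length_cons] at h1
    rw [cs.wordProd_cons]
    exact (ih hr).trans (reflLE_simple_mul (by omega))
  | @cons_cons ω' ω i h ih =>
    have hr : cs.IsReduced ω := hω.drop 1
    have h1 := hω.eq
    have h2 := hr.eq
    rw [cs.wordProd_cons, List.length_cons] at h1
    rw [cs.wordProd_cons, cs.wordProd_cons]
    exact (ih hr).simple_mul_of_lt (by omega)

theorem bruhatLE_iff_reflLE {u w : W} : bruhatLE cs u w ↔ ReflLE cs u w := by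
  constructor
  · rintro ⟨ω, rfl, hω, ω', hs, rfl, -⟩
    exact reflLE_of_sublist hs hω
  · intro h
    obtain ⟨ω, hω, rfl⟩ := cs.exists_isReduced w
    obtain ⟨ω', hs, rfl⟩ := h.exists_sublist
    obtain ⟨υ, hυ, hp, hr⟩ := exists_isReduced_sublist cs ω'
    exact ⟨ω, rfl, hω, υ, hυ.trans hs, hp, hr⟩

theorem ReflLE.le_or_simple_mul_le {u w : W} (h : ReflLE cs u w) (i : I) :
    ReflLE cs u (cs.simple i * w) ∨
      (ReflLE cs (cs.simple i * u) (cs.simple i * w) ∧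
        cs.length (cs.simple i * u) < cs.length u) := by
  obtain ⟨υ, hυ, hp⟩ := cs.exists_isReduced (cs.simple i * w)
  have hw : w = cs.wordProd (i :: υ) := by rw [cs.wordProd_cons, ← hp]; simp
  rw [hw] at h
  obtain ⟨ω', hs, rfl⟩ := h.exists_sublist
  obtain ⟨ω, hω, hp', hr⟩ := exists_isReduced_sublist cs ω'
  rw [← hp', hp]
  rcases List.sublist_cons_iff.mp (hω.trans hs) with h' | ⟨τ, rfl, h'⟩
  · exact Or.inl (reflLE_of_sublist h' hυ)
  · refine Or.inr ?_
    have h1 := hr.eq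
    have h2 := (show cs.IsReduced τ from hr.drop 1).eq
    rw [List.length_cons] at h1
    rw [cs.wordProd_cons] at h1 ⊢
    rw [cs.simple_mul_simple_cancel_left]
    exact ⟨reflLE_of_sublist h' hυ, by omega⟩

theorem ReflLE.simple_mul_le_simple_mul {u w : W} (h : ReflLE cs u w) {i : I}
    (hu : cs.length (cs.simple i * u) < cs.length u) :
    ReflLE cs (cs.simple i * u) (cs.simple i * w) :=
  (h.le_or_simple_mul_le i).elim (fun h' => (simple_mul_reflLE hu).trans h') And.left

theorem ReflLE.le_simple_mul {u w : W} (h : ReflLE cs u w) {i : I}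
    (hu : cs.length u < cs.length (cs.simple i * u)) :
    ReflLE cs u (cs.simple i * w) :=
  (h.le_or_simple_mul_le i).elim id (fun h' => absurd h'.2 hu.le.not_gt)

theorem length_mul_simple_eq_length_simple_mul_inv (w : W) (i : I) :
    cs.length (w * cs.simple i) = cs.length (cs.simple i * w⁻¹) := by
  rw [← cs.length_inv]
  simp

theorem reflLE_mul_simple {u : W} {i : I} (h : cs.length u < cs.length (u * cs.simple i)) :
    ReflLE cs u (u * cs.simple i) := by
  rw [length_mul_simple_eq_length_simple_mul_inv, ← cs.length_inv u] at h
  simpa using (reflLE_simple_mul h).inv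

theorem ReflLE.mul_simple_of_lt {u w : W} (h : ReflLE cs u w) {i : I}
    (hi : cs.length w < cs.length (w * cs.simple i)) :
    ReflLE cs (u * cs.simple i) (w * cs.simple i) := by
  rw [length_mul_simple_eq_length_simple_mul_inv, ← cs.length_inv w] at hi
  simpa using (h.inv.simple_mul_of_lt hi).inv

theorem ReflLE.mul_simple_le_mul_simple {u w : W} (h : ReflLE cs u w) {i : I}
    (hu : cs.length (u * cs.simple i) < cs.length u) :
    ReflLE cs (u * cs.simple i) (w * cs.simple i) := by
  rw [length_mul_simple_eq_length_simple_mul_inv, ← cs.length_inv u] at hu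
  simpa using (h.inv.simple_mul_le_simple_mul hu).inv

theorem ReflLE.le_mul_simple {u w : W} (h : ReflLE cs u w) {i : I}
    (hu : cs.length u < cs.length (u * cs.simple i)) :
    ReflLE cs u (w * cs.simple i) := by
  rw [length_mul_simple_eq_length_simple_mul_inv, ← cs.length_inv u] at hu
  simpa using (h.inv.le_simple_mul hu).inv

variable (cs) in
/-- If `s w` and `w s'` are shorter than `w` but `s w s'` is not, then `s w = w s'`. -/
theorem simple_mul_eq_mul_simple {w : W} {i j : I}
    (h : cs.length (cs.simple i * w) < cs.length w)
    (hij : cs.length w ≤ cs.length (cs.simple i * w * cs.simple j))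
    (hj : cs.length (w * cs.simple j) < cs.length w) :
    cs.simple i * w = w * cs.simple j := by
  obtain ⟨υ, hυ, hp⟩ := cs.exists_isReduced (w * cs.simple j)
  have hw : cs.wordProd (υ ++ [j]) = w := by
    rw [cs.wordProd_append, ← hp]
    simp
  obtain ⟨k, hk, he⟩ := exists_eraseIdx_of_isLeftInversion cs (ω := υ ++ [j])
    (t := cs.simple i) ⟨cs.isReflection_simple i, by rwa [hw]⟩
  rw [hw] at he
  have h1 := hυ.eq
  rw [← hp] at h1
  by_cases hkυ : k < υ.length
  · rw [List.eraseIdx_append_of_lt_length hkυ, cs.wordProd_append] at he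
    have h2 : cs.simple i * w * cs.simple j = cs.wordProd (υ.eraseIdx k) := by
      rw [he]
      simp
    have h3 := cs.length_wordProd_le (υ.eraseIdx k)
    have h4 := List.length_eraseIdx_of_lt hkυ
    rw [← h2] at h3
    omega
  · rw [List.length_append, List.length_singleton] at hk
    have hk' : k = υ.length := by omega
    subst hk'
    rw [he, hp, List.eraseIdx_append_of_length_le le_rfl]
    simp

end Bruhat

section Parabolic

variable {cs : CoxeterSystem M W}
  {J : Set I}

theorem wordProd_mem_parabolic {ω : List I} (h : ∀ i ∈ ω, i ∈ J) :
    cs.wordProd ω ∈ parabolic cs J := by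
  apply Subgroup.list_prod_mem
  intro x hx
  obtain ⟨i, hi, rfl⟩ := List.mem_map.mp hx
  exact Subgroup.subset_closure ⟨i, h i hi, rfl⟩

theorem simple_mem_parabolic {j : I} (hj : j ∈ J) : cs.simple j ∈ parabolic cs J :=
  Subgroup.subset_closure ⟨j, hj, rfl⟩

theorem exists_isReduced_of_mem_parabolic {x : W} (hx : x ∈ parabolic cs J) :
    ∃ ω : List I, (∀ i ∈ ω, i ∈ J) ∧ cs.IsReduced ω ∧ x = cs.wordProd ω := by
  suffices h : ∃ ω : List I, (∀ i ∈ ω, i ∈ J) ∧ x = cs.wordProd ω by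
    obtain ⟨ω, hω, rfl⟩ := h
    obtain ⟨υ, hυ, hp, hr⟩ := exists_isReduced_sublist cs ω
    exact ⟨υ, fun i hi => hω i (hυ.subset hi), hr, hp.symm⟩
  induction hx using Subgroup.closure_induction with
  | mem x hx =>
    obtain ⟨j, hj, rfl⟩ := hx
    exact ⟨[j], by simpa using hj, by simp⟩
  | one => exact ⟨[], by simp, by simp⟩
  | mul x y _ _ hx hy =>
    obtain ⟨ω, hω, rfl⟩ := hx
    obtain ⟨υ, hυ, rfl⟩ := hy
    refine ⟨ω ++ υ, fun i hi => ?_, (cs.wordProd_append _ _).symm⟩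
    exact (List.mem_append.mp hi).elim (hω i) (hυ i)
  | inv x _ hx =>
    obtain ⟨ω, hω, rfl⟩ := hx
    exact ⟨ω.reverse, by simpa using hω, by simp⟩

theorem length_mul_wordProd_of_minimal {a : W}
    (ha : ∀ x ∈ parabolic cs J, cs.length a ≤ cs.length (a * x)) {ω : List I}
    (hω : ∀ i ∈ ω, i ∈ J) (hr : cs.IsReduced ω) :
    cs.length (a * cs.wordProd ω) = cs.length a + ω.length := by
  induction ω using List.reverseRecOn with
  | nil => simp
  | append_singleton ω j ih =>
    have hωJ : ∀ i ∈ ω, i ∈ J := fun i hi => hω i (by simp [hi])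
    have hj : j ∈ J := hω j (by simp)
    have hr' : cs.IsReduced ω := by simpa using hr.take ω.length
    have hlen := ih hωJ hr'
    have hrl := hr.eq
    rw [List.length_append, List.length_singleton] at hrl ⊢
    rw [cs.wordProd_append, cs.wordProd_singleton, ← mul_assoc]
    rcases cs.length_mul_simple (a * cs.wordProd ω) j with h | h
    · omega
    exfalso
    obtain ⟨α, hα, rfl⟩ := cs.exists_isReduced a
    have hαl := hα.eq
    set g := cs.wordProd α * cs.wordProd ω with hg
    have hgw : cs.wordProd (α ++ ω) = g := cs.wordProd_append _ _
    have ht : g * cs.simple j * g⁻¹ * g = g * cs.simple j := by group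
    obtain ⟨k, hk, he⟩ := exists_eraseIdx_of_isLeftInversion cs (ω := α ++ ω)
      (t := g * cs.simple j * g⁻¹) ⟨⟨g, j, rfl⟩, by rw [hgw, ht]; omega⟩
    rw [hgw, ht] at he
    by_cases hkα : k < α.length
    · rw [List.eraseIdx_append_of_lt_length hkα, cs.wordProd_append] at he
      have hx : cs.wordProd ω * cs.simple j * (cs.wordProd ω)⁻¹ ∈ parabolic cs J :=
        mul_mem (mul_mem (wordProd_mem_parabolic hωJ) (simple_mem_parabolic hj))
          (inv_mem (wordProd_mem_parabolic hωJ))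
      have h1 := ha _ hx
      have h2 : cs.wordProd α * (cs.wordProd ω * cs.simple j * (cs.wordProd ω)⁻¹) =
          cs.wordProd (α.eraseIdx k) := by
        rw [← mul_assoc, ← mul_assoc, ← hg, he]
        simp
      rw [h2] at h1
      have h3 := cs.length_wordProd_le (α.eraseIdx k)
      have h4 := List.length_eraseIdx_of_lt hkα
      omega
    · rw [List.eraseIdx_append_of_length_le (not_lt.mp hkα), cs.wordProd_append, hg,
        mul_assoc] at he
      have h1 := mul_left_cancel he
      have h2 := cs.length_wordProd_le (ω.eraseIdx (k - α.length))
      rw [List.length_append] at hk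
      have h3 := List.length_eraseIdx_of_lt (l := ω) (i := k - α.length) (by omega)
      rw [← h1] at h2
      rw [cs.wordProd_append, cs.wordProd_singleton] at hrl
      omega

theorem mem_minRight_of_minimal {a : W}
    (ha : ∀ x ∈ parabolic cs J, cs.length a ≤ cs.length (a * x)) : a ∈ minRight cs J :=
  fun j hj => lt_of_le_of_ne (ha _ (simple_mem_parabolic hj)) (cs.length_mul_simple_ne a j).symm

variable (cs J) in
theorem exists_eq_mul_minimal (w : W) :
    ∃ a x, x ∈ parabolic cs J ∧ w = a * x ∧
      ∀ y ∈ parabolic cs J, cs.length a ≤ cs.length (a * y) := by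
  obtain ⟨a, ⟨x, hx, rfl⟩, hmin⟩ := exists_minimalFor_of_wellFoundedLT
    (fun a => ∃ x ∈ parabolic cs J, a = w * x) cs.length ⟨w, 1, one_mem _, by simp⟩
  refine ⟨w * x, x⁻¹, inv_mem hx, by simp, fun y hy => ?_⟩
  by_contra! h
  exact absurd (hmin ⟨x * y, mul_mem hx hy, by rw [mul_assoc]⟩ h.le) (not_le.mpr h)

theorem length_mul_of_mem_minRight {a x : W} (ha : a ∈ minRight cs J) (hx : x ∈ parabolic cs J) :
    cs.length (a * x) = cs.length a + cs.length x := by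
  obtain ⟨a₀, y, hy, rfl, hmin⟩ := exists_eq_mul_minimal cs J a
  obtain ⟨ω, hω, hr, rfl⟩ := exists_isReduced_of_mem_parabolic hy
  have hnil : ω = [] := by
    rcases List.eq_nil_or_concat ω with h | ⟨υ, j, rfl⟩
    · exact h
    exfalso
    rw [List.concat_eq_append] at *
    have hυ : cs.IsReduced υ := by simpa using hr.take υ.length
    have h1 := length_mul_wordProd_of_minimal hmin hω hr
    have h2 := length_mul_wordProd_of_minimal hmin (fun i hi => hω i (by simp [hi])) hυ
    have h3 := ha j (hω j (by simp))
    rw [h1, cs.wordProd_append, cs.wordProd_singleton, ← mul_assoc,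
      cs.simple_mul_simple_cancel_right, h2] at h3
    simp at h3
  subst hnil
  obtain ⟨υ, hυ, hr', rfl⟩ := exists_isReduced_of_mem_parabolic hx
  simpa [hr'.eq] using length_mul_wordProd_of_minimal hmin hυ hr'

theorem reflLE_mul_left {x y : W} (h : cs.length (x * y) = cs.length x + cs.length y) :
    ReflLE cs y (x * y) := by
  obtain ⟨α, hα, rfl⟩ := cs.exists_isReduced x
  obtain ⟨β, hβ, rfl⟩ := cs.exists_isReduced y
  rw [← cs.wordProd_append]
  apply reflLE_of_sublist (List.sublist_append_right α β)
  rw [CoxeterSystem.IsReduced, cs.wordProd_append, h, hα.eq, hβ.eq, List.length_append]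

theorem eq_of_reflLE_mul {a p x : W} (ha : a ∈ minRight cs J) (hx : x ∈ parabolic cs J)
    (h : ReflLE cs a (p * x)) (hl : cs.length p ≤ cs.length a) : a = p := by
  obtain ⟨α, hα, rfl⟩ := cs.exists_isReduced p
  obtain ⟨β, hβ, hβr, rfl⟩ := exists_isReduced_of_mem_parabolic hx
  rw [← cs.wordProd_append] at h
  obtain ⟨ω, hω, rfl⟩ := h.exists_sublist
  obtain ⟨α', β', rfl, hα', hβ'⟩ := List.sublist_append_iff.mp hω
  have hmem : cs.wordProd β' ∈ parabolic cs J :=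
    wordProd_mem_parabolic fun i hi => hβ i (hβ'.subset hi)
  have h1 := length_mul_of_mem_minRight ha (inv_mem hmem)
  rw [cs.wordProd_append, mul_inv_cancel_right, cs.length_inv, ← cs.wordProd_append] at h1
  have h2 := cs.length_wordProd_le α'
  have h3 := hα'.length_le
  rw [hα.eq] at hl
  have h4 : cs.wordProd β' = 1 := cs.length_eq_zero_iff.mp (by omega)
  rw [cs.wordProd_append, h4, mul_one, hα'.eq_of_length (by omega)]

end Parabolic

section TwistedOrbit

variable {cs : CoxeterSystem M W}
  {J : Set I} {δ : I ≃ I} {δW : W ≃* W}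

theorem map_wordProd (hδW : ∀ i : I, δW (cs.simple i) = cs.simple (δ i)) (ω : List I) :
    δW (cs.wordProd ω) = cs.wordProd (ω.map δ) := by
  induction ω with
  | nil => simp
  | cons i ω ih => rw [cs.wordProd_cons, map_mul, hδW, ih, List.map_cons, cs.wordProd_cons]

theorem length_map (hδW : ∀ i : I, δW (cs.simple i) = cs.simple (δ i)) (x : W) :
    cs.length (δW x) = cs.length x := by
  apply le_antisymm
  · obtain ⟨ω, hω, rfl⟩ := cs.exists_isReduced x
    rw [map_wordProd hδW, hω.eq]
    simpa using cs.length_wordProd_le (ω.map δ)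
  · obtain ⟨ω, hω, h⟩ := cs.exists_isReduced (δW x)
    have hx : x = cs.wordProd (ω.map δ.symm) := by
      apply δW.injective
      rw [map_wordProd hδW, h]
      simp
    rw [h, hω.eq, hx]
    simpa using cs.length_wordProd_le (ω.map δ.symm)

theorem conj_mem_orbit {w y x : W} (hy : y ∈ orbit cs J δW w) (hx : x ∈ parabolic cs J) :
    δW x * y * x⁻¹ ∈ orbit cs J δW w := by
  obtain ⟨z, hz, rfl⟩ := hy
  exact ⟨x * z, mul_mem hx hz, by simp [mul_assoc]⟩

theorem simple_conj_mem_orbit (hδW : ∀ i : I, δW (cs.simple i) = cs.simple (δ i)) {w y : W}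
    (hy : y ∈ orbit cs J δW w) {j : I} (hj : j ∈ J) :
    cs.simple (δ j) * y * cs.simple j ∈ orbit cs J δW w := by
  simpa [hδW] using conj_mem_orbit hy (simple_mem_parabolic hj)

theorem length_le_of_mem_orbit (hδW : ∀ i : I, δW (cs.simple i) = cs.simple (δ i)) {w y : W}
    (hw : w ∈ minRight cs J) (hy : y ∈ orbit cs J δW w) : cs.length w ≤ cs.length y := by
  obtain ⟨x, hx, rfl⟩ := hy
  have h1 := length_mul_of_mem_minRight hw (inv_mem hx)
  have h2 := cs.length_le_length_mul_add_left (δW x) (w * x⁻¹)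
  rw [length_map hδW, ← mul_assoc] at h2
  rw [cs.length_inv] at h1
  omega

theorem self_mem_orbit (w : W) : w ∈ orbit cs J δW w := ⟨1, one_mem _, by simp⟩

variable (cs J δ) in
/-- Twisted conjugation by a simple reflection of `J` that preserves the length. -/
def CyclicShift (y y' : W) : Prop :=
  ∃ j ∈ J, y' = cs.simple (δ j) * y * cs.simple j ∧ cs.length y' = cs.length y

theorem CyclicShift.symm {y y' : W} (h : CyclicShift cs J δ y y') : CyclicShift cs J δ y' y := by
  obtain ⟨j, hj, rfl, hl⟩ := h
  exact ⟨j, hj, by simp [mul_assoc], hl.symm⟩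

theorem mem_orbitMin_of_reflTransGen (hδW : ∀ i : I, δW (cs.simple i) = cs.simple (δ i))
    {w y y' : W} (hy : y ∈ orbitMin cs J δW w)
    (h : Relation.ReflTransGen (CyclicShift cs J δ) y y') : y' ∈ orbitMin cs J δW w := by
  induction h with
  | refl => exact hy
  | tail _ hs ih =>
    obtain ⟨j, hj, rfl, hl⟩ := hs
    exact ⟨simple_conj_mem_orbit hδW ih.1 hj, fun u hu => hl.trans_le (ih.2 u hu)⟩

theorem cyclicShift_mul_wordProd (hδW : ∀ i : I, δW (cs.simple i) = cs.simple (δ i))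
    {w : W} {ω : List I} (hω : ∀ i ∈ ω, i ∈ J) {a : W}
    (hmem : a * cs.wordProd ω ∈ orbitMin cs J δW w)
    (hl : cs.length (a * cs.wordProd ω) = cs.length a + ω.length) :
    Relation.ReflTransGen (CyclicShift cs J δ) (a * cs.wordProd ω) (δW (cs.wordProd ω) * a) := by
  induction ω using List.reverseRecOn generalizing a with
  | nil => simpa using Relation.ReflTransGen.refl
  | append_singleton ω j ih =>
    have hωJ : ∀ i ∈ ω, i ∈ J := fun i hi => hω i (by simp [hi])
    have hj : j ∈ J := hω j (by simp)
    have hshift : cs.simple (δ j) * (a * cs.wordProd (ω ++ [j])) * cs.simple j =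
        cs.simple (δ j) * a * cs.wordProd ω := by
      simp [cs.wordProd_append, mul_assoc]
    rw [List.length_append, List.length_singleton] at hl
    have h1 := hmem.2 _ (simple_conj_mem_orbit hδW hmem.1 hj)
    rw [hshift] at h1
    have h2 := cs.length_mul_le (cs.simple (δ j) * a) (cs.wordProd ω)
    have h3 := cs.length_wordProd_le ω
    have h4 := cs.length_simple_mul a (δ j)
    have hstep : CyclicShift cs J δ (a * cs.wordProd (ω ++ [j]))
        (cs.simple (δ j) * a * cs.wordProd ω) := ⟨j, hj, hshift.symm, by omega⟩
    have hrec := ih hωJ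
      (mem_orbitMin_of_reflTransGen hδW hmem (Relation.ReflTransGen.single hstep)) (by omega)
    refine Relation.ReflTransGen.head hstep ?_
    simpa [cs.wordProd_append, hδW, mul_assoc] using hrec

theorem cyclicShift_mul (hδW : ∀ i : I, δW (cs.simple i) = cs.simple (δ i)) {w a b : W}
    (ha : a ∈ minRight cs J) (hb : b ∈ parabolic cs J) (hmem : a * b ∈ orbitMin cs J δW w) :
    Relation.ReflTransGen (CyclicShift cs J δ) (a * b) (δW b * a) := by
  have hl := length_mul_of_mem_minRight ha hb
  obtain ⟨ω, hω, hr, rfl⟩ := exists_isReduced_of_mem_parabolic hb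
  exact cyclicShift_mul_wordProd hδW hω hmem (by rw [hl, hr.eq])

theorem eq_of_mem_orbit_of_mem_minRight (hδW : ∀ i : I, δW (cs.simple i) = cs.simple (δ i))
    {w v : W} (hw : w ∈ minRight cs J) (hv : v ∈ minRight cs J) (h : v ∈ orbit cs J δW w) :
    v = w := by
  obtain ⟨x, hx, he⟩ := h
  have hw' : w ∈ orbit cs J δW v := ⟨x⁻¹, inv_mem hx, by simp [he, mul_assoc]⟩
  have hl : cs.length w = cs.length v :=
    (length_le_of_mem_orbit hδW hw ⟨x, hx, he⟩).antisymm (length_le_of_mem_orbit hδW hv hw')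
  have hvx : v * x = δW x * w := by simp [he]
  have hle : ReflLE cs w (v * x) := by
    rw [hvx]
    apply reflLE_mul_left
    rw [← hvx, length_mul_of_mem_minRight hv hx, length_map hδW, hl, add_comm]
  exact (eq_of_reflLE_mul hw hx hle hl.ge).symm

/-- If the shifts of `a b₀`, `a b₁`, … keep the same `W^J`-part `a`, then `a` is at least as long
as the representative of the orbit in `W^J`. -/
theorem length_le_of_sequence (hδW : ∀ i : I, δW (cs.simple i) = cs.simple (δ i)) {w a : W}
    (hw : w ∈ minRight cs J) (b : ℕ → W) (hb : ∀ n, b n ∈ parabolic cs J)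
    (hshift : ∀ n, δW (b n) * a = a * b (n + 1)) (hmem : a * b 0 ∈ orbit cs J δW w) :
    cs.length w ≤ cs.length a := by
  obtain ⟨x, hx, he⟩ := hmem
  have key : ∀ n, ∃ y ∈ parabolic cs J, w * y = δW y * (a * b n) ∧
      n * cs.length w + cs.length y ≤ cs.length x + n * cs.length a := by
    intro n
    induction n with
    | zero => exact ⟨x⁻¹, inv_mem hx, by simp [he, mul_assoc], by simp⟩
    | succ n ih =>
      obtain ⟨y, hy, hwy, hle⟩ := ih
      have hy' : y * (b n)⁻¹ ∈ parabolic cs J := mul_mem hy (inv_mem (hb n))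
      have h1 : w * (y * (b n)⁻¹) = δW y * a := by
        rw [← mul_assoc, hwy]
        simp [mul_assoc]
      refine ⟨y * (b n)⁻¹, hy', ?_, ?_⟩
      · rw [h1, ← hshift]
        simp [mul_assoc]
      · have h2 := length_mul_of_mem_minRight hw hy'
        have h3 := cs.length_mul_le (δW y) a
        rw [← h1, h2, length_map hδW] at h3
        linarith
  by_contra! hlt
  obtain ⟨y, -, -, hle⟩ := key (cs.length x + 1)
  nlinarith

theorem reflTransGen_cyclicShift (hδW : ∀ i : I, δW (cs.simple i) = cs.simple (δ i)) {w v : W}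
    (hw : w ∈ minRight cs J) (hv : v ∈ orbitMin cs J δW w) :
    Relation.ReflTransGen (CyclicShift cs J δ) v w := by
  let S : W × W → Prop := fun p => p.1 ∈ minRight cs J ∧ p.2 ∈ parabolic cs J ∧
    Relation.ReflTransGen (CyclicShift cs J δ) v (p.1 * p.2)
  have hdecomp : ∀ y, ∃ a b, a ∈ minRight cs J ∧ b ∈ parabolic cs J ∧ y = a * b := by
    intro y
    obtain ⟨a, b, hb, he, hmin⟩ := exists_eq_mul_minimal cs J y
    exact ⟨a, b, mem_minRight_of_minimal hmin, hb, he⟩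
  obtain ⟨a₀, b₀, ha₀, hb₀, he₀⟩ := hdecomp v
  obtain ⟨⟨a, b⟩, ⟨ha, hb, hab⟩, hmin⟩ := exists_minimalFor_of_wellFoundedLT S
    (fun p => cs.length p.2) ⟨(a₀, b₀), ha₀, hb₀, he₀ ▸ Relation.ReflTransGen.refl⟩
  dsimp only at ha hb hab hmin
  have hstep : ∀ c : {c : W // c ∈ parabolic cs J ∧ cs.length c = cs.length b ∧
      Relation.ReflTransGen (CyclicShift cs J δ) v (a * c)},
      ∃ d : {c : W // c ∈ parabolic cs J ∧ cs.length c = cs.length b ∧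
      Relation.ReflTransGen (CyclicShift cs J δ) v (a * c)}, δW c * a = a * d := by
    rintro ⟨c, hc, hcl, hvc⟩
    have hac := mem_orbitMin_of_reflTransGen hδW hv hvc
    have hshift := cyclicShift_mul hδW ha hc hac
    have hmem := mem_orbitMin_of_reflTransGen hδW hac hshift
    have hlen : cs.length (δW c * a) = cs.length (a * c) :=
      (hmem.2 _ hac.1).antisymm (hac.2 _ hmem.1)
    have h1 := length_mul_of_mem_minRight ha hc
    obtain ⟨a', d, ha', hd, he⟩ := hdecomp (δW c * a)
    have h2 := length_mul_of_mem_minRight ha' hd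
    rw [← he] at h2
    have h3 : cs.length b ≤ cs.length d := by
      by_contra! hlt
      have hS : S (a', d) := ⟨ha', hd, he ▸ hvc.trans hshift⟩
      exact absurd (hmin hS hlt.le) (not_le.mpr hlt)
    have haa : a = a' := by
      refine eq_of_reflLE_mul ha hd ?_ (by omega)
      rw [← he]
      exact reflLE_mul_left (by rw [length_map hδW]; omega)
    subst haa
    exact ⟨⟨d, hd, by omega, he ▸ hvc.trans hshift⟩, he⟩
  choose f hf using hstep
  let seq : ℕ → {c : W // c ∈ parabolic cs J ∧ cs.length c = cs.length b ∧
      Relation.ReflTransGen (CyclicShift cs J δ) v (a * c)} := fun n => f^[n] ⟨b, hb, rfl, hab⟩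
  have habm := mem_orbitMin_of_reflTransGen hδW hv hab
  have hle : cs.length w ≤ cs.length a :=
    length_le_of_sequence hδW hw (fun n => (seq n : W)) (fun n => (seq n).2.1)
      (fun n => by
        simp only [seq, Function.iterate_succ_apply']
        exact hf _) habm.1
  have h1 := length_mul_of_mem_minRight ha hb
  have h2 := habm.2 w (self_mem_orbit w)
  have hb1 : b = 1 := cs.length_eq_zero_iff.mp (by omega)
  subst hb1
  rw [mul_one] at hab habm
  rwa [eq_of_mem_orbit_of_mem_minRight hδW hw ha habm.1] at hab

/-- A minimal length element of an orbit meeting `W^J` is not of the form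
`s_{δ(j)} v s_j = v` with `v s_j < v`. -/
theorem simple_mul_ne_mul_simple (hδW : ∀ i : I, δW (cs.simple i) = cs.simple (δ i)) {w v : W}
    (hw : w ∈ minRight cs J) (hv : v ∈ orbitMin cs J δW w) {j : I} (hj : j ∈ J)
    (hlt : cs.length (v * cs.simple j) < cs.length v) :
    cs.simple (δ j) * v ≠ v * cs.simple j := by
  intro he
  obtain ⟨q, ⟨hq, hvq⟩, hmin⟩ := exists_minimalFor_of_wellFoundedLT
    (fun q => q ∈ parabolic cs J ∧ v = δW q * w * q⁻¹) cs.length hv.1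
  have hsj := simple_mem_parabolic (cs := cs) hj
  have hsq : cs.simple j * q ∈ parabolic cs J := mul_mem hsj hq
  have hle : cs.length q ≤ cs.length (cs.simple j * q) := by
    by_contra! h
    refine absurd (hmin ⟨hsq, ?_⟩ h.le) (not_le.mpr h)
    calc v = cs.simple (δ j) * v * cs.simple j := by rw [he]; simp
      _ = _ := by
        conv_lhs => rw [hvq]
        simp [hδW, mul_assoc]
  have h1 := length_mul_of_mem_minRight hw (inv_mem hsq)
  have h2 : w * (cs.simple j * q)⁻¹ = (δW q)⁻¹ * (v * cs.simple j) := by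
    rw [hvq]
    simp [mul_assoc]
  have h3 := cs.length_mul_le (δW q)⁻¹ (v * cs.simple j)
  have h4 := hv.2 w (self_mem_orbit w)
  have h5 := cs.length_simple_mul q j
  rw [← h2, h1, cs.length_inv, cs.length_inv, length_map hδW] at h3
  omega

/-- Being above a minimal length element of the orbit of `w` is invariant under cyclic shifts. -/
theorem exists_reflLE_of_cyclicShift (hδW : ∀ i : I, δW (cs.simple i) = cs.simple (δ i))
    {w y y' : W} (hw : w ∈ minRight cs J) (hs : CyclicShift cs J δ y y')
    (h : ∃ v ∈ orbitMin cs J δW w, ReflLE cs v y) :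
    ∃ v ∈ orbitMin cs J δW w, ReflLE cs v y' := by
  obtain ⟨j, hj, rfl, hl⟩ := hs
  obtain ⟨v, hv, hvy⟩ := h
  have hbad := simple_mul_ne_mul_simple hδW hw hv hj
  have hconj := simple_conj_mem_orbit hδW hv.1 hj
  have hge := hv.2 _ hconj
  have hmin : cs.length (cs.simple (δ j) * v * cs.simple j) ≤ cs.length v →
      cs.simple (δ j) * v * cs.simple j ∈ orbitMin cs J δW w :=
    fun h => ⟨hconj, fun u hu => h.trans (hv.2 u hu)⟩
  have d1 := cs.length_simple_mul v (δ j)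
  have d2 := cs.length_mul_simple v j
  have d3 := cs.length_mul_simple (cs.simple (δ j) * v) j
  by_cases hdd : cs.length (cs.simple (δ j) * v) < cs.length v ∧
      cs.length (v * cs.simple j) < cs.length v
  · exact absurd (simple_mul_eq_mul_simple cs hdd.1 hge hdd.2) (hbad hdd.2)
  rcases cs.length_mul_simple y j with hyr | hyr
  · have hup : ReflLE cs y (y * cs.simple j) := reflLE_mul_simple (by omega)
    rw [mul_assoc]
    rcases d2 with hvr | hvr
    · have h1 : ReflLE cs (v * cs.simple j) (y * cs.simple j) := hvy.mul_simple_of_lt (by omega)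
      by_cases h2 : cs.length (cs.simple (δ j) * (v * cs.simple j)) < cs.length (v * cs.simple j)
      · refine ⟨_, hmin (by rw [mul_assoc]; omega), ?_⟩
        rw [mul_assoc]
        exact h1.simple_mul_le_simple_mul h2
      · have h3 := cs.length_simple_mul_ne (v * cs.simple j) (δ j)
        exact ⟨v, hv, (reflLE_mul_simple (by omega)).trans (h1.le_simple_mul (by omega))⟩
    · exact ⟨v, hv, (hvy.trans hup).le_simple_mul (by omega)⟩
  · rcases cs.length_simple_mul y (δ j) with hyl | hyl
    · have hup : ReflLE cs y (cs.simple (δ j) * y) := reflLE_simple_mul (by omega)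
      rcases d1 with hvl | hvl
      · have h1 : ReflLE cs (cs.simple (δ j) * v) (cs.simple (δ j) * y) :=
          hvy.simple_mul_of_lt (by omega)
        rcases d3 with h2 | h2
        · exact ⟨v, hv, (reflLE_simple_mul (by omega)).trans (h1.le_mul_simple (by omega))⟩
        · exact ⟨_, hmin (by omega), h1.mul_simple_le_mul_simple (by omega)⟩
      · exact ⟨v, hv, (hvy.trans hup).le_mul_simple (by omega)⟩
    · have he := simple_mul_eq_mul_simple cs (w := y) (i := δ j) (j := j) (by omega) hl.ge
        (by omega)
      refine ⟨v, hv, ?_⟩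
      rwa [he, cs.simple_mul_simple_cancel_right]

end TwistedOrbit

/-- in the definition of `≤_{J,δ}`, "for some minimal element" is equivalent
to "for any minimal element". -/
theorem le_some_imp_le_all
    [Fintype I] [Finite W]
    (cs : CoxeterSystem M W) (J : Set I) (δ : I ≃ I)
    (hδM : ∀ i j : I, M (δ i) (δ j) = M i j)
    (δW : W ≃* W) (hδW : ∀ i : I, δW (cs.simple i) = cs.simple (δ i))
    (w w' : W) (hw : w ∈ minRight cs J) (hw' : w' ∈ minRight cs J)
    (h : ∃ v' ∈ orbitMin cs J δW w', ∃ v ∈ orbitMin cs J δW w, bruhatLE cs v v') :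
    ∀ u' ∈ orbitMin cs J δW w', ∃ u ∈ orbitMin cs J δW w, bruhatLE cs u u' := by
  obtain ⟨v', hv', v, hv, hvv'⟩ := h
  intro u' hu'
  have key : ∀ {y y' : W}, Relation.ReflTransGen (CyclicShift cs J δ) y y' →
      (∃ v ∈ orbitMin cs J δW w, ReflLE cs v y) → ∃ v ∈ orbitMin cs J δW w, ReflLE cs v y' := by
    intro y y' hyy' hy
    induction hyy' with
    | refl => exact hy
    | tail _ hs ih => exact exists_reflLE_of_cyclicShift hδW hw hs ih
  have hsymm : Relation.ReflTransGen (CyclicShift cs J δ) w' u' := by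
    have hpath := reflTransGen_cyclicShift hδW hw' hu'
    clear hw' hu' hv' key
    induction hpath with
    | refl => exact .refl
    | tail _ hs ih => exact .head hs.symm ih
  obtain ⟨u, hu, huu'⟩ := key ((reflTransGen_cyclicShift hδW hw' hv').trans hsymm)
    ⟨v, hv, bruhatLE_iff_reflLE.mp hvv'⟩
  exact ⟨u, hu, bruhatLE_iff_reflLE.mpr huu'⟩

end HePaper
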